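/- Let G = [g_1,…,g_N] be a stepping sequence for m, and let T_0 = S_m = {1,…,m}, T_1, …, T_N be the sequence of generated sets (T_t is the set generated at step t). Then the following are equivalent: (a) |T_{t−1} Δ T_t| = 1 for all 1 ≤ t ≤ N and the final set T_N is a singleton; (b) G is strongly contiguous, i.e., |g_t − g_{t+1}| = 1 for all 1 ≤ t < N, g_1 = m − 1, and g_N = 1. (Here Δ denotes symmetric difference.) -/

import Mathlib

open List

/-- The initial configuration `(1, 2, …, m)`. -/
def initConfig (m : ℕ) : List ℕ := (List.range m).map (· + 1)

/-- A move at index `i` (with `1 ≤ i ≤ m-1`) transposes the entries `q_i` and `q_{i+1}`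
(one-indexed), i.e. the entries at zero-indexed positions `i-1` and `i`. -/
def swapAdj (q : List ℕ) (i : ℕ) : List ℕ :=
  (q.set (i - 1) (q.getD i 0)).set i (q.getD (i - 1) 0)

/-- The prefix set `S_k(q) = {q_1, …, q_k}`. -/
def prefixSet (q : List ℕ) (k : ℕ) : Finset ℕ := (q.take k).toFinset

/-- The initial prefix sets `S_0 ⊂ S_1 ⊂ … ⊂ S_m` of the configuration `(1,…,m)`. -/
def initSets (m : ℕ) : List (Finset ℕ) :=
  (List.range (m + 1)).map (fun k => prefixSet (initConfig m) k)

/-- The sets generated by applying a sequence of moves starting from configuration `q`: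
the `t`-th generated set is the prefix set of length `i_t` of the configuration
obtained after the `t`-th move. -/
def genSetsAux (q : List ℕ) : List ℕ → List (Finset ℕ)
  | [] => []
  | i :: rest => prefixSet (swapAdj q i) i :: genSetsAux (swapAdj q i) rest

/-- The sets generated by the moves, starting from the initial configuration `(1,…,m)`. -/
def genSets (m : ℕ) (moves : List ℕ) : List (Finset ℕ) :=
  genSetsAux (initConfig m) moves

/-- `moves` is a stepping sequence for `m`: each move index lies in `{1,…,m-1}`, and the
initial prefix sets `S_0,…,S_m` together with the generated sets list every subset of
`{1,…,m}` exactly once. -/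
def IsSteppingSeq (m : ℕ) (moves : List ℕ) : Prop :=
  (∀ i ∈ moves, 1 ≤ i ∧ i ≤ m - 1) ∧
  (initSets m ++ genSets m moves).Perm (Finset.Icc 1 m).powerset.toList

/-- A list of moves is contiguous if consecutive entries differ by exactly 1. -/
def ContiguousList (G : List ℕ) : Prop :=
  ∀ t, t + 1 < G.length → ((G.getD t 0 : ℤ) - (G.getD (t + 1) 0 : ℤ)).natAbs = 1

/-- A stepping sequence for `m` is strongly contiguous if it is contiguous, begins
with `m-1`, and ends with `1`. -/
def StronglyContiguous (m : ℕ) (G : List ℕ) : Prop :=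
  ContiguousList G ∧ G.head? = some (m - 1) ∧ G.getLast? = some 1

open scoped symmDiff

theorem swapAdj_perm {q : List ℕ} {i : ℕ} (h : i < q.length) : (swapAdj q i).Perm q := by
  have h' : i - 1 < q.length := by omega
  simp only [swapAdj, List.getD_eq_getElem _ _ h, List.getD_eq_getElem _ _ h']
  exact List.set_set_perm h' h

theorem prefixSet_swapAdj {q : List ℕ} {i g : ℕ} (h : i < q.length) (hg : g ≠ i) :
    prefixSet (swapAdj q i) g = prefixSet q g := by
  unfold prefixSet
  rcases lt_or_gt_of_ne hg with hlt | hgt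
  · rw [swapAdj, List.take_set_of_le (by omega), List.take_set_of_le (by omega)]
  · have key : (swapAdj q i).take g = swapAdj (q.take g) i := by
      have h' : i - 1 < q.length := by omega
      have h1 : i < (q.take g).length := by simp; omega
      have h2 : i - 1 < (q.take g).length := by simp; omega
      simp only [swapAdj, List.getD_eq_getElem _ _ h, List.getD_eq_getElem _ _ h',
        List.getD_eq_getElem _ _ h1, List.getD_eq_getElem _ _ h2, List.take_set,
        List.getElem_take]
    rw [key]
    exact List.toFinset_eq_of_perm _ _ (swapAdj_perm (by simp; omega))

theorem card_prefixSet {q : List ℕ} (hq : q.Nodup) {k : ℕ} (hk : k ≤ q.length) :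
    (prefixSet q k).card = k := by
  rw [prefixSet, List.toFinset_card_of_nodup (hq.sublist (List.take_sublist _ _))]
  simpa using hk

theorem prefixSet_mono (q : List ℕ) : Monotone (prefixSet q) := fun _ _ h =>
  fun _ hx => List.mem_toFinset.2 ((List.take_subset_take_left q h) (List.mem_toFinset.1 hx))

theorem card_symmDiff_prefixSet {q : List ℕ} (hq : q.Nodup) {j k : ℕ} (hj : j ≤ q.length)
    (hk : k ≤ q.length) :
    (prefixSet q j ∆ prefixSet q k).card = ((j : ℤ) - (k : ℤ)).natAbs := by
  rcases le_total j k with h | h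
  · rw [symmDiff_of_le (prefixSet_mono q h), Finset.card_sdiff_of_subset (prefixSet_mono q h),
      card_prefixSet hq hj, card_prefixSet hq hk]
    omega
  · rw [symmDiff_of_ge (prefixSet_mono q h), Finset.card_sdiff_of_subset (prefixSet_mono q h),
      card_prefixSet hq hj, card_prefixSet hq hk]
    omega

theorem card_symmDiff_ne_one_of_card_eq {A B : Finset ℕ} (h : A.card = B.card) :
    (A ∆ B).card ≠ 1 := by
  have hd : Disjoint (A \ B) (B \ A) := disjoint_sdiff_sdiff
  have hcard : (A ∆ B).card = (A \ B).card + (B \ A).card := Finset.card_union_of_disjoint hd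
  have h1 := Finset.card_sdiff_add_card_inter A B
  have h2 := Finset.card_sdiff_add_card_inter B A
  rw [Finset.inter_comm] at h2
  omega

theorem card_symmDiff_prefixSet_swapAdj {q : List ℕ} (hq : q.Nodup) {g i : ℕ}
    (hg : g ≤ q.length) (hi : i < q.length) :
    (prefixSet q g ∆ prefixSet (swapAdj q i) i).card = 1 ↔
      ((g : ℤ) - (i : ℤ)).natAbs = 1 := by
  have hp := swapAdj_perm hi
  have hq' := hp.nodup_iff.2 hq
  have hl := hp.length_eq
  by_cases h : g = i
  · subst h
    have hne : (prefixSet q g ∆ prefixSet (swapAdj q g) g).card ≠ 1 :=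
      card_symmDiff_ne_one_of_card_eq <| by
        rw [card_prefixSet hq hg, card_prefixSet hq' (hl ▸ hg)]
    simp [hne]
  · rw [← prefixSet_swapAdj hi h, card_symmDiff_prefixSet hq' (by omega) (by omega)]

theorem isChain_genSetsAux {G : List ℕ} : ∀ {q : List ℕ} {g : ℕ}, q.Nodup → g ≤ q.length →
    (∀ i ∈ G, i < q.length) →
    ((prefixSet q g :: genSetsAux q G).IsChain (fun A B => (A ∆ B).card = 1) ↔
      (g :: G).IsChain (fun a b : ℕ => ((a : ℤ) - (b : ℤ)).natAbs = 1)) := by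
  induction G with
  | nil => intro q g _ _ _; simp [genSetsAux]
  | cons i G ih =>
    intro q g hq hg hG
    have hi : i < q.length := hG i (by simp)
    have hp := swapAdj_perm hi
    have hl := hp.length_eq
    rw [genSetsAux, List.isChain_cons_cons, List.isChain_cons_cons,
      card_symmDiff_prefixSet_swapAdj hq hg hi,
      ih (hp.nodup_iff.2 hq) (by omega) (fun j hj => hl ▸ hG j (by simp [hj]))]

theorem card_getLast_genSetsAux {G : List ℕ} : ∀ {q : List ℕ} {g : ℕ}, q.Nodup →
    g ≤ q.length → (∀ i ∈ G, i < q.length) →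
    ((prefixSet q g :: genSetsAux q G).getLast (List.cons_ne_nil _ _)).card =
      (g :: G).getLast (List.cons_ne_nil _ _) := by
  induction G with
  | nil => intro q g hq hg _; simpa [genSetsAux] using card_prefixSet hq hg
  | cons i G ih =>
    intro q g hq hg hG
    have hi : i < q.length := hG i (by simp)
    have hp := swapAdj_perm hi
    have hl := hp.length_eq
    have := ih (hp.nodup_iff.2 hq) (g := i) (by omega) (fun j hj => hl ▸ hG j (by simp [hj]))
    simpa only [genSetsAux, List.getLast_cons_cons] using this

theorem forall_getD_iff_isChain {α : Type*} (R : α → α → Prop) (d : α) (l : List α) :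
    (∀ t, t + 1 < l.length → R (l.getD t d) (l.getD (t + 1) d)) ↔ l.IsChain R := by
  rw [List.isChain_iff_getElem]
  refine forall_congr' fun t => forall_congr' fun h => ?_
  rw [List.getD_eq_getElem _ _ h, List.getD_eq_getElem _ _ (by omega)]

theorem length_initConfig (m : ℕ) : (initConfig m).length = m := by simp [initConfig]

theorem nodup_initConfig (m : ℕ) : (initConfig m).Nodup :=
  List.nodup_range.map (add_left_injective 1)

theorem prefixSet_initConfig_self (m : ℕ) : prefixSet (initConfig m) m = Finset.Icc 1 m := by
  have h : (initConfig m).take m = initConfig m :=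
    List.take_of_length_le (length_initConfig m).le
  ext x
  rw [prefixSet, h]
  simp only [initConfig, List.mem_toFinset, List.mem_map, List.mem_range,
    Finset.mem_Icc]
  constructor
  · rintro ⟨a, ha, rfl⟩; omega
  · rintro ⟨h1, h2⟩; exact ⟨x - 1, by omega, by omega⟩

/-- Lemma 6.1: a stepping sequence gives rise to a cyclic Gray code (consecutive
generated sets, starting from `T₀ = {1,…,m}`, differ in exactly one element, and the
final set is a singleton) if and only if it is strongly contiguous. -/
theorem grayCode_iff_stronglyContiguous (m : ℕ) (hm : 2 ≤ m) (G : List ℕ)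
    (hG : IsSteppingSeq m G) :
    ((∀ t, t + 1 < (Finset.Icc 1 m :: genSets m G).length →
        (((Finset.Icc 1 m :: genSets m G).getD t ∅)
          ∆ ((Finset.Icc 1 m :: genSets m G).getD (t + 1) ∅)).card = 1) ∧
      ((Finset.Icc 1 m :: genSets m G).getLast (List.cons_ne_nil _ _)).card = 1) ↔
    StronglyContiguous m G := by
  have hlen := length_initConfig m
  have hlt : ∀ i ∈ G, i < (initConfig m).length := fun i hi => by
    have := hG.1 i hi
    omega
  rw [forall_getD_iff_isChain (fun A B : Finset ℕ => (A ∆ B).card = 1), genSets,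
    StronglyContiguous, ContiguousList,
    forall_getD_iff_isChain (fun a b : ℕ => ((a : ℤ) - (b : ℤ)).natAbs = 1)]
  simp only [← prefixSet_initConfig_self m]
  rw [isChain_genSetsAux (nodup_initConfig m) hlen.ge hlt,
    card_getLast_genSetsAux (nodup_initConfig m) hlen.ge hlt]
  cases G with
  | nil => simp; omega
  | cons i G =>
    have hi := hG.1 i (by simp)
    have hstep : ((m : ℤ) - (i : ℤ)).natAbs = 1 ↔ i = m - 1 := by omega
    rw [List.isChain_cons_cons, hstep, List.getLast_cons_cons,
      List.getLast?_eq_some_getLast (List.cons_ne_nil _ _)]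
    simp only [List.head?_cons, Option.some.injEq]
    tauto
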